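/- Let X be a topological space and F : X → Set ℝ a set-valued map. The following are equivalent: (1) F is a minimal cusco map; (2) F has nonempty compact convex values, the graph of F is closed in X × ℝ, the functions sup F (x ↦ sup (F x)) and inf F (x ↦ inf (F x)) are quasicontinuous and subcontinuous, and the closures of the graphs of sup F and inf F coincide; (3) F has nonempty compact values, sup F and inf F are quasicontinuous and subcontinuous, and for every x ∈ X, F x equals the convex hull of {y : (x,y) ∈ closure of the graph of sup F} and also equals the convex hull of {y : (x,y) ∈ closure of the graph of inf F}. -/

import Mathlib

open Filter Set Topology

section Defs

variable {X Y : Type*}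

/-- `F` is upper semicontinuous at `x` (as a set-valued map). -/
def UscoAt [TopologicalSpace X] [TopologicalSpace Y] (F : X → Set Y) (x : X) : Prop :=
  ∀ V : Set Y, IsOpen V → F x ⊆ V → ∃ U ∈ 𝓝 x, ∀ u ∈ U, F u ⊆ V

/-- `F` is usco: upper semicontinuous everywhere with nonempty compact values. -/
def IsUsco [TopologicalSpace X] [TopologicalSpace Y] (F : X → Set Y) : Prop :=
  (∀ x, (F x).Nonempty) ∧ (∀ x, IsCompact (F x)) ∧ (∀ x, UscoAt F x)

/-- `F` is a minimal usco map. -/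
def IsMinimalUsco [TopologicalSpace X] [TopologicalSpace Y] (F : X → Set Y) : Prop :=
  IsUsco F ∧ ∀ G : X → Set Y, IsUsco G → (∀ x, G x ⊆ F x) → G = F

/-- `F` is cusco: usco with convex values. -/
def IsCusco [TopologicalSpace X] [TopologicalSpace Y] [AddCommGroup Y] [Module ℝ Y]
    (F : X → Set Y) : Prop :=
  IsUsco F ∧ ∀ x, Convex ℝ (F x)

/-- `F` is a minimal cusco map. -/
def IsMinimalCusco [TopologicalSpace X] [TopologicalSpace Y] [AddCommGroup Y] [Module ℝ Y]
    (F : X → Set Y) : Prop :=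
  IsCusco F ∧ ∀ G : X → Set Y, IsCusco G → (∀ x, G x ⊆ F x) → G = F

/-- `f` is quasicontinuous at `x`. -/
def QuasicontinuousAt [TopologicalSpace X] [TopologicalSpace Y] (f : X → Y) (x : X) : Prop :=
  ∀ V : Set Y, IsOpen V → f x ∈ V → ∀ U : Set X, IsOpen U → x ∈ U →
    ∃ G : Set X, IsOpen G ∧ G.Nonempty ∧ G ⊆ U ∧ f '' G ⊆ V

/-- `f` is quasicontinuous. -/
def Quasicontinuous [TopologicalSpace X] [TopologicalSpace Y] (f : X → Y) : Prop :=
  ∀ x, QuasicontinuousAt f x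

/-- `f` is subcontinuous at `x`: the image of every ultrafilter converging to `x` converges. -/
def SubcontinuousAt [TopologicalSpace X] [TopologicalSpace Y] (f : X → Y) (x : X) : Prop :=
  ∀ 𝔘 : Ultrafilter X, (𝔘 : Filter X) ≤ 𝓝 x → ∃ y : Y, Tendsto f 𝔘 (𝓝 y)

/-- `f` is subcontinuous. -/
def Subcontinuous [TopologicalSpace X] [TopologicalSpace Y] (f : X → Y) : Prop :=
  ∀ x, SubcontinuousAt f x

/-- The closure-of-graph map of `f` : the value at `x` is the vertical section at `x`
of the closure of the graph of `f`. -/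
def graphCl [TopologicalSpace X] [TopologicalSpace Y] (f : X → Y) (x : X) : Set Y :=
  {y | (x, y) ∈ closure {p : X × Y | p.2 = f p.1}}

/-- `f` is hyperplane minimal. -/
def HyperplaneMinimal [TopologicalSpace X] [TopologicalSpace Y] [AddCommGroup Y] [Module ℝ Y]
    (f : X → Y) : Prop :=
  ∀ (l : Y →L[ℝ] ℝ) (lam : ℝ) (U : Set X), IsOpen U → U.Nonempty →
    (f '' U ∩ {y : Y | lam < l y}).Nonempty →
    ∃ V : Set X, IsOpen V ∧ V.Nonempty ∧ V ⊆ U ∧ f '' V ⊆ {y : Y | lam < l y}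

/-- A densely defined `f : A → Y` is subcontinuous at `x ∈ X`: the image of every ultrafilter
on `A` converging to `x` in `X` converges in `Y`. -/
def DSubcontinuousAt [TopologicalSpace X] [TopologicalSpace Y] (A : Set X) (f : A → Y)
    (x : X) : Prop :=
  ∀ 𝔘 : Ultrafilter A, Tendsto (Subtype.val : A → X) 𝔘 (𝓝 x) → ∃ y : Y, Tendsto f 𝔘 (𝓝 y)

/-- The closure-of-graph map of a densely defined function `f : A → Y`. -/
def dGraphCl [TopologicalSpace X] [TopologicalSpace Y] (A : Set X) (f : A → Y) (x : X) : Set Y :=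
  {y | (x, y) ∈ closure {p : X × Y | ∃ a : A, p = ((a : X), f a)}}

/-- A densely defined `f : A → Y` is hyperplane minimal. -/
def DHyperplaneMinimal [TopologicalSpace X] [TopologicalSpace Y] [AddCommGroup Y] [Module ℝ Y]
    (A : Set X) (f : A → Y) : Prop :=
  ∀ (l : Y →L[ℝ] ℝ) (lam : ℝ) (U : Set X), IsOpen U →
    (f '' ((Subtype.val : A → X) ⁻¹' U) ∩ {y : Y | lam < l y}).Nonempty →
    ∃ V : Set X, IsOpen V ∧ V.Nonempty ∧ V ⊆ U ∧
      f '' ((Subtype.val : A → X) ⁻¹' V) ⊆ {y : Y | lam < l y}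

end Defs

theorem IsUsco.eventually_subset {X Y : Type*} [TopologicalSpace X] [TopologicalSpace Y]
    {F : X → Set Y} (hF : IsUsco F) {x : X} {V : Set Y} (hV : IsOpen V) (h : F x ⊆ V) :
    ∀ᶠ z in 𝓝 x, F z ⊆ V := by
  obtain ⟨U, hU, hUV⟩ := hF.2.2 x V hV h
  exact mem_of_superset hU hUV

theorem IsUsco.isClosed_graph {X Y : Type*} [TopologicalSpace X] [TopologicalSpace Y] [T2Space Y]
    {F : X → Set Y} (hF : IsUsco F) : IsClosed {p : X × Y | p.2 ∈ F p.1} := by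
  rw [← isOpen_compl_iff, isOpen_iff_mem_nhds]
  rintro ⟨x, y⟩ hxy
  have hy : y ∉ F x := hxy
  obtain ⟨V, W, hV, hW, hFV, hyW, hVW⟩ :=
    SeparatedNhds.of_isCompact_isCompact (hF.2.1 x) (isCompact_singleton (x := y))
      (disjoint_singleton_right.2 hy)
  filter_upwards [prod_mem_nhds (hF.eventually_subset hV hFV)
    (hW.mem_nhds (singleton_subset_iff.1 hyW))] with p hp hpF
  exact disjoint_left.1 hVW (hp.1 hpF) hp.2

/-- Every selection of a usco map is subcontinuous. -/
theorem IsUsco.subcontinuous {X Y : Type*} [TopologicalSpace X] [TopologicalSpace Y]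
    {F : X → Set Y} (hF : IsUsco F) {f : X → Y} (hf : ∀ x, f x ∈ F x) : Subcontinuous f := by
  intro x 𝔘 h𝔘
  by_contra! hlim
  have hN : ∀ y ∈ F x, ∃ N, IsOpen N ∧ y ∈ N ∧ ∀ᶠ z in (𝔘 : Filter X), f z ∉ N := by
    intro y _
    have h := hlim y
    rw [(nhds_basis_opens y).tendsto_right_iff] at h
    push Not at h
    obtain ⟨N, ⟨hyN, hN⟩, hfN⟩ := h
    exact ⟨N, hN, hyN, Ultrafilter.eventually_not.2 (by simpa using hfN)⟩
  choose! N hNo hyN hfN using hN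
  obtain ⟨t, ht, htN⟩ := (hF.2.1 x).elim_nhds_subcover N
    fun y hy => (hNo y hy).mem_nhds (hyN y hy)
  have hin : ∀ᶠ z in (𝔘 : Filter X), F z ⊆ ⋃ y ∈ t, N y :=
    h𝔘 (hF.eventually_subset (isOpen_biUnion fun y hy => hNo y (ht y hy)) htN)
  have hout : ∀ᶠ z in (𝔘 : Filter X), ∀ y ∈ t, f z ∉ N y :=
    (t.eventually_all).2 fun y hy => hfN y (ht y hy)
  obtain ⟨z, hz, hz'⟩ := (hin.and hout).exists
  obtain ⟨y, hy, hzy⟩ := mem_iUnion₂.1 (hz (hf z))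
  exact hz' y hy hzy

/-- A minimal cusco map that meets a closed convex set everywhere on an open set
takes values inside that set there. -/
theorem IsMinimalCusco.subset_of_forall_nonempty_inter {X Y : Type*} [TopologicalSpace X]
    [TopologicalSpace Y] [AddCommGroup Y] [Module ℝ Y] {F : X → Set Y} (hF : IsMinimalCusco F)
    {U : Set X} (hU : IsOpen U) {C : Set Y} (hC : IsClosed C) (hconv : Convex ℝ C)
    (h : ∀ z ∈ U, (F z ∩ C).Nonempty) {x : X} (hx : x ∈ U) : F x ⊆ C := by
  classical
  have hpos : ∀ z ∈ U, (if z ∈ U then F z ∩ C else F z) = F z ∩ C := fun z hz => if_pos hz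
  have hneg : ∀ z ∉ U, (if z ∈ U then F z ∩ C else F z) = F z := fun z hz => if_neg hz
  have hle : ∀ z, (if z ∈ U then F z ∩ C else F z) ⊆ F z := by
    intro z
    split_ifs
    exacts [inter_subset_left, Subset.rfl]
  have hG : IsCusco fun z => if z ∈ U then F z ∩ C else F z := by
    refine ⟨⟨fun z => ?_, fun z => ?_, fun z V hV hzV => ?_⟩, fun z => ?_⟩
    · by_cases hz : z ∈ U
      · simpa only [hpos z hz] using h z hz
      · simpa only [hneg z hz] using hF.1.1.1 z
    · by_cases hz : z ∈ U
      · simpa only [hpos z hz] using (hF.1.1.2.1 z).inter_right hC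
      · simpa only [hneg z hz] using hF.1.1.2.1 z
    · by_cases hz : z ∈ U
      · simp only [hpos z hz] at hzV
        have hsub : F z ⊆ V ∪ Cᶜ := fun y hy => by
          by_cases hyC : y ∈ C
          exacts [Or.inl (hzV ⟨hy, hyC⟩), Or.inr hyC]
        refine ⟨_, inter_mem (hF.1.1.eventually_subset (hV.union hC.isOpen_compl) hsub)
          (hU.mem_nhds hz), fun w hw => ?_⟩
        simp only [hpos w hw.2]
        exact fun y hy => (hw.1 hy.1).resolve_right fun hyC => hyC hy.2
      · simp only [hneg z hz] at hzV
        exact ⟨_, hF.1.1.eventually_subset hV hzV, fun w hw => (hle w).trans hw⟩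
    · by_cases hz : z ∈ U
      · simpa only [hpos z hz] using (hF.1.2 z).inter hconv
      · simpa only [hneg z hz] using hF.1.2 z
  have hx' := congrFun (hF.2 _ hG hle) x
  simp only [hpos x hx] at hx'
  exact inter_eq_left.1 hx'

theorem IsMinimalCusco.exists_isOpen_forall_subset_diff {X Y : Type*} [TopologicalSpace X]
    [TopologicalSpace Y] [AddCommGroup Y] [Module ℝ Y] {F : X → Set Y} (hF : IsMinimalCusco F)
    {C K : Set Y} (hC : IsClosed C) (hconv : Convex ℝ C) (hK : IsOpen K) {x : X}
    (hxC : ¬ F x ⊆ C) (hxK : F x ⊆ K) {U : Set X} (hU : IsOpen U) (hx : x ∈ U) :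
    ∃ W, IsOpen W ∧ W.Nonempty ∧ W ⊆ U ∧ ∀ w ∈ W, F w ⊆ K \ C := by
  obtain ⟨T, hTK, hT, hxT⟩ := eventually_nhds_iff.1 (hF.1.1.eventually_subset hK hxK)
  have : ∃ z ∈ U ∩ T, ¬ (F z ∩ C).Nonempty := by
    by_contra! h
    exact hxC (hF.subset_of_forall_nonempty_inter (hU.inter hT) hC hconv h ⟨hx, hxT⟩)
  obtain ⟨z, hz, hzC⟩ := this
  have hzC' : F z ⊆ Cᶜ := fun y hy hyC => hzC ⟨y, hy, hyC⟩
  obtain ⟨S, hSC, hS, hzS⟩ :=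
    eventually_nhds_iff.1 (hF.1.1.eventually_subset hC.isOpen_compl hzC')
  exact ⟨U ∩ T ∩ S, (hU.inter hT).inter hS, ⟨z, hz, hzS⟩, fun w hw => hw.1.1,
    fun w hw y hy => ⟨hTK w hw.1.2 hy, hSC w hw.2 hy⟩⟩

theorem IsMinimalCusco.exists_isOpen_forall_subset_of_sSup_mem {X : Type*} [TopologicalSpace X]
    {F : X → Set ℝ} (hF : IsMinimalCusco F) {x : X} {V : Set ℝ} (hV : IsOpen V)
    (hxV : sSup (F x) ∈ V) {U : Set X} (hU : IsOpen U) (hx : x ∈ U) :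
    ∃ W, IsOpen W ∧ W.Nonempty ∧ W ⊆ U ∧ ∀ w ∈ W, F w ⊆ V := by
  obtain ⟨a, b, hab, hsub⟩ := mem_nhds_iff_exists_Ioo_subset.1 (hV.mem_nhds hxV)
  have hcpt := hF.1.1.2.1 x
  obtain ⟨W, hW, hne, hWU, h⟩ := hF.exists_isOpen_forall_subset_diff (isClosed_Iic (a := a))
    (convex_Iic a) (isOpen_Iio (a := b))
    (fun h => hab.1.not_ge (h (hcpt.sSup_mem (hF.1.1.1 x))))
    (fun y hy => (le_csSup hcpt.bddAbove hy).trans_lt hab.2) hU hx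
  exact ⟨W, hW, hne, hWU, fun w hw y hy => hsub ⟨not_le.1 (h w hw hy).2, (h w hw hy).1⟩⟩

theorem IsMinimalCusco.exists_isOpen_forall_subset_of_sInf_mem {X : Type*} [TopologicalSpace X]
    {F : X → Set ℝ} (hF : IsMinimalCusco F) {x : X} {V : Set ℝ} (hV : IsOpen V)
    (hxV : sInf (F x) ∈ V) {U : Set X} (hU : IsOpen U) (hx : x ∈ U) :
    ∃ W, IsOpen W ∧ W.Nonempty ∧ W ⊆ U ∧ ∀ w ∈ W, F w ⊆ V := by
  obtain ⟨a, b, hab, hsub⟩ := mem_nhds_iff_exists_Ioo_subset.1 (hV.mem_nhds hxV)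
  have hcpt := hF.1.1.2.1 x
  obtain ⟨W, hW, hne, hWU, h⟩ := hF.exists_isOpen_forall_subset_diff (isClosed_Ici (a := b))
    (convex_Ici b) (isOpen_Ioi (a := a))
    (fun h => hab.2.not_ge (h (hcpt.sInf_mem (hF.1.1.1 x))))
    (fun y hy => hab.1.trans_le (csInf_le hcpt.bddBelow hy)) hU hx
  exact ⟨W, hW, hne, hWU, fun w hw y hy => hsub ⟨(h w hw hy).1, not_le.1 (h w hw hy).2⟩⟩

/-- A selection `f` of `F` is quasicontinuous as soon as, arbitrarily close to each point `x`,
`F` takes values near `f x` on a nonempty open set. -/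
theorem quasicontinuous_of_forall_exists_isOpen {X Y : Type*} [TopologicalSpace X]
    [TopologicalSpace Y] {F : X → Set Y} {f : X → Y} (hf : ∀ x, f x ∈ F x)
    (h : ∀ x V, IsOpen V → f x ∈ V → ∀ U, IsOpen U → x ∈ U →
      ∃ W, IsOpen W ∧ W.Nonempty ∧ W ⊆ U ∧ ∀ w ∈ W, F w ⊆ V) : Quasicontinuous f := by
  intro x V hV hxV U hU hx
  obtain ⟨W, hW, hne, hWU, hWV⟩ := h x V hV hxV U hU hx
  exact ⟨W, hW, hne, hWU, image_subset_iff.2 fun w hw => hWV w hw (hf w)⟩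

theorem graph_subset_closure_graph_of_forall_exists_isOpen {X Y : Type*} [TopologicalSpace X]
    [TopologicalSpace Y] {F : X → Set Y} {f g : X → Y} (hg : ∀ x, g x ∈ F x)
    (h : ∀ x V, IsOpen V → f x ∈ V → ∀ U, IsOpen U → x ∈ U →
      ∃ W, IsOpen W ∧ W.Nonempty ∧ W ⊆ U ∧ ∀ w ∈ W, F w ⊆ V) :
    {p : X × Y | p.2 = f p.1} ⊆ closure {p : X × Y | p.2 = g p.1} := by
  rintro ⟨x, y⟩ hy
  obtain rfl : y = f x := hy
  rw [mem_closure_iff_nhds]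
  intro N hN
  obtain ⟨U, V, hU, hx, hV, hxV, hUV⟩ := mem_nhds_prod_iff'.1 hN
  obtain ⟨W, -, ⟨w, hw⟩, hWU, hWV⟩ := h x V hV hxV U hU hx
  exact ⟨(w, g w), hUV ⟨hWU hw, hWV w hw (hg w)⟩, rfl⟩

theorem mem_graphCl {X Y : Type*} [TopologicalSpace X] [TopologicalSpace Y] (f : X → Y) (x : X) :
    f x ∈ graphCl f x :=
  subset_closure (s := {p : X × Y | p.2 = f p.1}) (rfl : f x = f x)

theorem graphCl_subset_of_isClosed_graph {X Y : Type*} [TopologicalSpace X] [TopologicalSpace Y]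
    {F : X → Set Y} (hF : IsClosed {p : X × Y | p.2 ∈ F p.1}) {f : X → Y} (hf : ∀ x, f x ∈ F x)
    (x : X) : graphCl f x ⊆ F x := by
  have hsub : {p : X × Y | p.2 = f p.1} ⊆ {p : X × Y | p.2 ∈ F p.1} := by
    rintro ⟨z, y⟩ hy
    obtain rfl : y = f z := hy
    exact hf z
  exact fun y hy => closure_minimal hsub hF hy

theorem graphCl_subset_of_eventually_mem {X Y : Type*} [TopologicalSpace X] [TopologicalSpace Y]
    {f : X → Y} {x : X} {C : Set Y} (hC : IsClosed C) (h : ∀ᶠ z in 𝓝 x, f z ∈ C) :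
    graphCl f x ⊆ C := by
  intro y hy
  by_contra hyC
  obtain ⟨⟨z, w⟩, hz, hw⟩ := mem_closure_iff_nhds.1 hy _
    (prod_mem_nhds h (hC.isOpen_compl.mem_nhds hyC))
  obtain rfl : w = f z := hw
  exact hz.2 hz.1

theorem SubcontinuousAt.eventually_mem {X Y : Type*} [TopologicalSpace X] [TopologicalSpace Y]
    {f : X → Y} {x : X} (hf : SubcontinuousAt f x) {V : Set Y} (hV : IsOpen V)
    (h : graphCl f x ⊆ V) : ∀ᶠ z in 𝓝 x, f z ∈ V := by
  change {z | f z ∈ V} ∈ 𝓝 x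
  rw [mem_iff_ultrafilter]
  intro 𝔘 h𝔘
  obtain ⟨y, hy⟩ := hf 𝔘 h𝔘
  refine hy (hV.mem_nhds (h ?_))
  exact mem_closure_of_tendsto ((tendsto_id'.2 h𝔘).prodMk_nhds hy)
    (Eventually.of_forall fun _ => rfl)

/-- If `F` lies in the convex hulls of the sections of the closed graph of a quasicontinuous `f`,
then `f` is a selection of every cusco map contained in `F`. -/
theorem IsCusco.mem_of_subset_convexHull_graphCl {X Y : Type*} [TopologicalSpace X]
    [AddCommGroup Y] [Module ℝ Y] [TopologicalSpace Y] [IsTopologicalAddGroup Y]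
    [ContinuousSMul ℝ Y] [LocallyConvexSpace ℝ Y] [T2Space Y] {G : X → Set Y} (hG : IsCusco G)
    {f : X → Y} (hf : Quasicontinuous f) (hGf : ∀ x, G x ⊆ convexHull ℝ (graphCl f x)) (x : X) :
    f x ∈ G x := by
  by_contra hx
  obtain ⟨l, c, hlG, hlx⟩ :=
    geometric_hahn_banach_closed_point (hG.2 x) (hG.1.2.1 x).isClosed hx
  obtain ⟨U, hUG, hU, hxU⟩ := eventually_nhds_iff.1
    (hG.1.eventually_subset (isOpen_Iio.preimage l.continuous) hlG)
  obtain ⟨W, hW, ⟨z, hz⟩, hWU, hfW⟩ :=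
    hf x _ (isOpen_Ioi.preimage l.continuous) hlx U hU hxU
  obtain ⟨y, hy⟩ := hG.1.1 z
  have hsub : graphCl f z ⊆ {y | c ≤ l y} :=
    graphCl_subset_of_eventually_mem (isClosed_Ici.preimage l.continuous)
      (eventually_of_mem (hW.mem_nhds hz) fun w hw =>
        (show c < l (f w) from image_subset_iff.1 hfW hw).le)
  have hle : c ≤ l y :=
    convexHull_min hsub (convex_halfSpace_ge l.toLinearMap.isLinear c) (hGf z hy)
  exact hle.not_gt (hUG z (hWU hz) hy)

theorem isUsco_of_subcontinuous_sSup_sInf {X : Type*} [TopologicalSpace X] {F : X → Set ℝ}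
    (hne : ∀ x, (F x).Nonempty) (hcpt : ∀ x, IsCompact (F x)) (hconv : ∀ x, Convex ℝ (F x))
    (hs : Subcontinuous fun x => sSup (F x)) (hi : Subcontinuous fun x => sInf (F x))
    (hsF : ∀ x, graphCl (fun z => sSup (F z)) x ⊆ F x)
    (hiF : ∀ x, graphCl (fun z => sInf (F z)) x ⊆ F x) : IsUsco F := by
  refine ⟨hne, hcpt, fun x V hV hxV => ?_⟩
  obtain ⟨b, hb, hbV⟩ :=
    exists_Ico_subset_of_mem_nhds (hV.mem_nhds (hxV ((hcpt x).sSup_mem (hne x)))) (exists_gt _)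
  obtain ⟨a, ha, haV⟩ :=
    exists_Ioc_subset_of_mem_nhds (hV.mem_nhds (hxV ((hcpt x).sInf_mem (hne x)))) (exists_lt _)
  have hsb : ∀ᶠ z in 𝓝 x, sSup (F z) ∈ Iio b := (hs x).eventually_mem isOpen_Iio
    fun y hy => (le_csSup (hcpt x).bddAbove (hsF x hy)).trans_lt hb
  have hia : ∀ᶠ z in 𝓝 x, sInf (F z) ∈ Ioi a := (hi x).eventually_mem isOpen_Ioi
    fun y hy => ha.trans_le (csInf_le (hcpt x).bddBelow (hiF x hy))
  refine ⟨_, hsb.and hia, fun z hz y hy => ?_⟩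
  have hyb : y < b := (le_csSup (hcpt z).bddAbove hy).trans_lt hz.1
  have hya : a < y := hz.2.trans_le (csInf_le (hcpt z).bddBelow hy)
  rcases le_total (sSup (F x)) y with h | h
  · exact hbV ⟨h, hyb⟩
  rcases le_total y (sInf (F x)) with h' | h'
  · exact haV ⟨hya, h'⟩
  exact hxV ((hconv x).ordConnected.out ((hcpt x).sInf_mem (hne x)) ((hcpt x).sSup_mem (hne x))
    ⟨h', h⟩)

variable {X : Type*} [TopologicalSpace X]

theorem stmt17 (F : X → Set ℝ) :
    [IsMinimalCusco F,
     (∀ x, (F x).Nonempty ∧ IsCompact (F x) ∧ Convex ℝ (F x)) ∧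
       IsClosed {p : X × ℝ | p.2 ∈ F p.1} ∧
       Quasicontinuous (fun x => sSup (F x)) ∧ Subcontinuous (fun x => sSup (F x)) ∧
       Quasicontinuous (fun x => sInf (F x)) ∧ Subcontinuous (fun x => sInf (F x)) ∧
       closure {p : X × ℝ | p.2 = sSup (F p.1)} = closure {p : X × ℝ | p.2 = sInf (F p.1)},
     (∀ x, (F x).Nonempty ∧ IsCompact (F x)) ∧
       Quasicontinuous (fun x => sSup (F x)) ∧ Subcontinuous (fun x => sSup (F x)) ∧
       Quasicontinuous (fun x => sInf (F x)) ∧ Subcontinuous (fun x => sInf (F x)) ∧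
       (∀ x, F x = convexHull ℝ (graphCl (fun z => sSup (F z)) x) ∧
         F x = convexHull ℝ (graphCl (fun z => sInf (F z)) x))].TFAE := by
  have hIcc : ∀ {s t : Set ℝ}, IsCompact s → Convex ℝ t → sInf s ∈ t → sSup s ∈ t → s ⊆ t :=
    fun hs ht hi hu y hy =>
      ht.ordConnected.out hi hu ⟨csInf_le hs.bddBelow hy, le_csSup hs.bddAbove hy⟩
  tfae_have 1 → 2 := by
    intro hF
    have hs : ∀ x, sSup (F x) ∈ F x := fun x => (hF.1.1.2.1 x).sSup_mem (hF.1.1.1 x)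
    have hi : ∀ x, sInf (F x) ∈ F x := fun x => (hF.1.1.2.1 x).sInf_mem (hF.1.1.1 x)
    have hS := fun x V (hV : IsOpen V) hxV U (hU : IsOpen U) (hx : x ∈ U) =>
      hF.exists_isOpen_forall_subset_of_sSup_mem hV hxV hU hx
    have hI := fun x V (hV : IsOpen V) hxV U (hU : IsOpen U) (hx : x ∈ U) =>
      hF.exists_isOpen_forall_subset_of_sInf_mem hV hxV hU hx
    exact ⟨fun x => ⟨hF.1.1.1 x, hF.1.1.2.1 x, hF.1.2 x⟩, hF.1.1.isClosed_graph,
      quasicontinuous_of_forall_exists_isOpen hs hS, hF.1.1.subcontinuous hs,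
      quasicontinuous_of_forall_exists_isOpen hi hI, hF.1.1.subcontinuous hi,
      (closure_minimal (graph_subset_closure_graph_of_forall_exists_isOpen hi hS)
        isClosed_closure).antisymm
      (closure_minimal (graph_subset_closure_graph_of_forall_exists_isOpen hs hI)
        isClosed_closure)⟩
  tfae_have 2 → 3 := by
    rintro ⟨hF, hcl, hqs, hss, hqi, hsi, heq⟩
    have heq' : ∀ x, graphCl (fun z => sSup (F z)) x = graphCl (fun z => sInf (F z)) x :=
      fun x => congrArg (fun S : Set (X × ℝ) => {y | (x, y) ∈ S}) heq
    have h : ∀ x, F x = convexHull ℝ (graphCl (fun z => sSup (F z)) x) := fun x =>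
      (hIcc (hF x).2.1 (convex_convexHull ℝ _)
        (subset_convexHull ℝ _ (heq' x ▸ mem_graphCl (fun z => sInf (F z)) x))
        (subset_convexHull ℝ _ (mem_graphCl (fun z => sSup (F z)) x))).antisymm
      (convexHull_min (graphCl_subset_of_isClosed_graph hcl
        (fun z => (hF z).2.1.sSup_mem (hF z).1) x) (hF x).2.2)
    exact ⟨fun x => ⟨(hF x).1, (hF x).2.1⟩, hqs, hss, hqi, hsi,
      fun x => ⟨h x, heq' x ▸ h x⟩⟩
  tfae_have 3 → 1 := by
    rintro ⟨hF, hqs, hss, hqi, hsi, hhull⟩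
    have hconv : ∀ x, Convex ℝ (F x) := fun x => (hhull x).1 ▸ convex_convexHull ℝ _
    refine ⟨⟨isUsco_of_subcontinuous_sSup_sInf (fun x => (hF x).1) (fun x => (hF x).2) hconv hss
      hsi (fun x => (subset_convexHull ℝ _).trans (hhull x).1.ge)
      (fun x => (subset_convexHull ℝ _).trans (hhull x).2.ge), hconv⟩, fun G hG hGF => ?_⟩
    exact funext fun x => (hGF x).antisymm <| hIcc (hF x).2 (hG.2 x)
      (hG.mem_of_subset_convexHull_graphCl hqi (fun z => (hGF z).trans (hhull z).2.le) x)
      (hG.mem_of_subset_convexHull_graphCl hqs (fun z => (hGF z).trans (hhull z).1.le) x)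
  tfae_finish
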